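/- The axioms R1: (Δφ ∧ Δψ) → Δ(φ∧ψ) and R2: (∘φ ∧ ∘ψ) → ∘(φ∧ψ) are valid on every quasi-filter, i.e., on every neighborhood model satisfying (i) and (s), for all L(∇,•)-formulas φ and ψ. -/

import Mathlib

/-- The language L(∇,•) over propositional variables indexed by ℕ. -/
inductive Formula : Type
  | atom : ℕ → Formula
  | neg : Formula → Formula
  | and : Formula → Formula → Formula
  | nabla : Formula → Formula
  | bullet : Formula → Formula

namespace Formula

/-- Disjunction, defined from ¬ and ∧ as usual. -/
def or (φ ψ : Formula) : Formula := neg ((neg φ).and (neg ψ))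

/-- Implication, defined from ¬ and ∧ as usual. -/
def imp (φ ψ : Formula) : Formula := (neg φ).or ψ

/-- Biimplication, defined from ¬ and ∧ as usual. -/
def biimp (φ ψ : Formula) : Formula := (φ.imp ψ).and (ψ.imp φ)

/-- A fixed tautology ⊤. -/
def top : Formula := (atom 0).imp (atom 0)

/-- Δφ := ¬∇φ. -/
def delta (φ : Formula) : Formula := neg (nabla φ)

/-- ∘φ := ¬•φ. -/
def circ (φ : Formula) : Formula := neg (bullet φ)

end Formula

/-- A neighborhood model. -/
structure NbhdModel : Type 1 where
  S : Type
  ne : Nonempty S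
  N : S → Set (Set S)
  V : ℕ → Set S

namespace NbhdModel

/-- The truth set ⟦φ⟧_M of a formula in a neighborhood model. -/
def truthSet (M : NbhdModel) : Formula → Set M.S
  | .atom p => M.V p
  | .neg φ => (M.truthSet φ)ᶜ
  | .and φ ψ => M.truthSet φ ∩ M.truthSet ψ
  | .nabla φ => {s | M.truthSet φ ∉ M.N s ∧ (M.truthSet φ)ᶜ ∉ M.N s}
  | .bullet φ => {s | s ∈ M.truthSet φ ∧ M.truthSet φ ∉ M.N s}

/-- M,s ⊨ φ. -/
def Sat (M : NbhdModel) (s : M.S) (φ : Formula) : Prop := s ∈ M.truthSet φ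

/-- Property (n): N(s) contains the unit. -/
def PropN (M : NbhdModel) : Prop := ∀ s : M.S, (Set.univ : Set M.S) ∈ M.N s

/-- Property (r): N(s) contains its core. -/
def PropR (M : NbhdModel) : Prop := ∀ s : M.S, ⋂₀ (M.N s) ∈ M.N s

/-- Property (i): N(s) is closed under binary intersections. -/
def PropI (M : NbhdModel) : Prop :=
  ∀ (s : M.S) (X Y : Set M.S), X ∈ M.N s → Y ∈ M.N s → X ∩ Y ∈ M.N s

/-- Property (s): N(s) is supplemented (closed under supersets). -/
def PropS (M : NbhdModel) : Prop :=
  ∀ (s : M.S) (X Y : Set M.S), X ∈ M.N s → X ⊆ Y → Y ∈ M.N s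

/-- Property (c): N(s) is closed under complements. -/
def PropC (M : NbhdModel) : Prop :=
  ∀ (s : M.S) (X : Set M.S), X ∈ M.N s → Xᶜ ∈ M.N s

/-- Property (d). -/
def PropD (M : NbhdModel) : Prop :=
  ∀ (s : M.S) (X : Set M.S), X ∈ M.N s → Xᶜ ∉ M.N s

/-- Property (t). -/
def PropT (M : NbhdModel) : Prop :=
  ∀ (s : M.S) (X : Set M.S), X ∈ M.N s → s ∈ X

/-- Property (b). -/
def PropB (M : NbhdModel) : Prop :=
  ∀ (s : M.S) (X : Set M.S), s ∈ X → {u : M.S | Xᶜ ∉ M.N u} ∈ M.N s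

/-- Property (4). -/
def Prop4 (M : NbhdModel) : Prop :=
  ∀ (s : M.S) (X : Set M.S), X ∈ M.N s → {u : M.S | X ∈ M.N u} ∈ M.N s

/-- Property (5). -/
def Prop5 (M : NbhdModel) : Prop :=
  ∀ (s : M.S) (X : Set M.S), X ∉ M.N s → {u : M.S | X ∉ M.N u} ∈ M.N s

end NbhdModel

namespace NbhdModel

variable (M : NbhdModel) (s : M.S) (φ ψ : Formula)

theorem sat_and : M.Sat s (φ.and ψ) ↔ M.Sat s φ ∧ M.Sat s ψ := Iff.rfl

theorem sat_imp : M.Sat s (φ.imp ψ) ↔ (M.Sat s φ → M.Sat s ψ) := by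
  simp only [Formula.imp, Formula.or, Sat, truthSet, Set.mem_compl_iff, Set.mem_inter_iff]
  tauto

theorem sat_delta :
    M.Sat s φ.delta ↔ M.truthSet φ ∈ M.N s ∨ (M.truthSet φ)ᶜ ∈ M.N s := by
  simp only [Formula.delta, Sat, truthSet, Set.mem_compl_iff, Set.mem_ofPred_eq]
  tauto

theorem sat_circ : M.Sat s φ.circ ↔ (M.Sat s φ → M.truthSet φ ∈ M.N s) := by
  simp only [Formula.circ, Sat, truthSet, Set.mem_compl_iff, Set.mem_ofPred_eq]
  tauto

end NbhdModel

/-- the axioms R1 and R2 are valid on every quasi-filter. -/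
theorem R_axioms_valid_on_quasi_filters (M : NbhdModel)
    (hi : M.PropI) (hs : M.PropS) (φ ψ : Formula) (s : M.S) :
    M.Sat s (((Formula.delta φ).and (Formula.delta ψ)).imp
      (Formula.delta (φ.and ψ))) ∧
    M.Sat s (((Formula.circ φ).and (Formula.circ ψ)).imp
      (Formula.circ (φ.and ψ))) := by
  simp only [NbhdModel.sat_imp, NbhdModel.sat_and, NbhdModel.sat_delta, NbhdModel.sat_circ,
    NbhdModel.truthSet]
  constructor
  · rintro ⟨hφ | hφ, hψ | hψ⟩
    · exact Or.inl (hi s _ _ hφ hψ)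
    · exact Or.inr (hs s _ _ hψ (Set.compl_subset_compl.mpr Set.inter_subset_right))
    all_goals exact Or.inr (hs s _ _ hφ (Set.compl_subset_compl.mpr Set.inter_subset_left))
  · rintro ⟨hφ, hψ⟩ ⟨hsφ, hsψ⟩
    exact hi s _ _ (hφ hsφ) (hψ hsψ)
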